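/- Elimination of bisimulation quantifiers in Full Modal Team Logic: for every FMTL formula φ and propositional letter p, there exists an FMTL formula θ which is equivalent to ∃̃p φ, i.e. for all team models (M,X): (M,X) ⊨ θ iff there exists (N,Y) with (N,Y) ⇌_{Free(φ)∖{p}} (M,X) and (N,Y) ⊨ φ. -/

import Mathlib

/-- A Kripke model `M = (W, R, V)` over a set `V` of propositional letters. -/
structure KModel (V : Type) : Type 1 where
  W : Type
  R : W → W → Prop
  val : W → V → Prop

variable {V : Type}

/-- `B` is a `P`-bisimulation between the Kripke models `M` and `N`:
related points agree on all propositions of `P`, and `B` satisfies the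
forth and back conditions. -/
def IsBisim (P : Set V) (M N : KModel V) (B : M.W → N.W → Prop) : Prop :=
  (∀ w v, B w v → ∀ p ∈ P, (M.val w p ↔ N.val v p)) ∧
  (∀ w v, B w v → ∀ w', M.R w w' → ∃ v', N.R v v' ∧ B w' v') ∧
  (∀ w v, B w v → ∀ v', N.R v v' → ∃ w', M.R w w' ∧ B w' v')

/-- `(M,w) ⇌_P (N,v)`: some `P`-bisimulation relates `w` and `v`. -/
def Bisimilar (P : Set V) (M : KModel V) (w : M.W) (N : KModel V) (v : N.W) : Prop :=
  ∃ B, IsBisim P M N B ∧ B w v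

/-- Team `P`-bisimulation `(M,X) ⇌_P (N,Y)`: every point of `X` is
`P`-bisimilar to some point of `Y` and conversely. -/
def TeamBisim (P : Set V) (M : KModel V) (X : Set M.W) (N : KModel V) (Y : Set N.W) : Prop :=
  (∀ x ∈ X, ∃ y ∈ Y, Bisimilar P M x N y) ∧
  (∀ y ∈ Y, ∃ x ∈ X, Bisimilar P M x N y)

/-- Formulas of Full Modal Team Logic: literals, `⊥`, `NE`, `∧`, `⊗`, `∨`,
`◇`, `□`. -/
inductive MForm (V : Type) : Type where
  | var : V → MForm V
  | nvar : V → MForm V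
  | bot : MForm V
  | ne : MForm V
  | and : MForm V → MForm V → MForm V
  | tens : MForm V → MForm V → MForm V
  | or : MForm V → MForm V → MForm V
  | dia : MForm V → MForm V
  | box : MForm V → MForm V

/-- `R(X) = {t : ∃ s ∈ X, sRt}`. -/
def KModel.img (M : KModel V) (X : Set M.W) : Set M.W := {t | ∃ s ∈ X, M.R s t}

/-- `X R Y`: every point of `X` has an `R`-successor in `Y` and every point
of `Y` has an `R`-predecessor in `X`. -/
def teamR (M : KModel V) (X Y : Set M.W) : Prop :=
  (∀ x ∈ X, ∃ y ∈ Y, M.R x y) ∧ (∀ y ∈ Y, ∃ x ∈ X, M.R x y)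

/-- Modal team semantics of Full Modal Team Logic. -/
def MSat (M : KModel V) : Set M.W → MForm V → Prop
  | X, .var p => ∀ s ∈ X, M.val s p
  | X, .nvar p => ∀ s ∈ X, ¬ M.val s p
  | X, .bot => X = ∅
  | X, .ne => X ≠ ∅
  | X, .and φ ψ => MSat M X φ ∧ MSat M X ψ
  | X, .tens φ ψ => ∃ X₁ X₂, X = X₁ ∪ X₂ ∧ MSat M X₁ φ ∧ MSat M X₂ ψ
  | X, .or φ ψ => MSat M X φ ∨ MSat M X ψ
  | X, .dia φ => ∃ Y, teamR M X Y ∧ MSat M Y φ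
  | X, .box φ => MSat M (M.img X) φ

/-- The set `L(φ)` of propositional letters occurring in `φ` (these are
exactly the free variables of an `FMTL` formula). -/
def mletters : MForm V → Set V
  | .var p => {p}
  | .nvar p => {p}
  | .bot => ∅
  | .ne => ∅
  | .and φ ψ => mletters φ ∪ mletters ψ
  | .tens φ ψ => mletters φ ∪ mletters ψ
  | .or φ ψ => mletters φ ∪ mletters ψ
  | .dia φ => mletters φ
  | .box φ => mletters φ

theorem Set.image_eq_image_iff_exists {α β γ : Type*} {f : α → γ} {g : β → γ} {s : Set α} {t : Set β} :
    f '' s = g '' t ↔ (∀ x ∈ s, ∃ y ∈ t, f x = g y) ∧ (∀ y ∈ t, ∃ x ∈ s, f x = g y) := by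
  constructor
  · intro h
    constructor
    · intro x hx
      obtain ⟨y, hy, e⟩ := h.subset (Set.mem_image_of_mem f hx)
      exact ⟨y, hy, e.symm⟩
    · intro y hy
      exact h.superset (Set.mem_image_of_mem g hy)
  · rintro ⟨h₁, h₂⟩
    apply Set.Subset.antisymm
    · rintro _ ⟨x, hx, rfl⟩
      obtain ⟨y, hy, e⟩ := h₁ x hx
      exact ⟨y, hy, e.symm⟩
    · rintro _ ⟨y, hy, rfl⟩
      exact h₂ y hy

/-- The space of `k`-bisimulation types over a set `Q` of letters. -/
def BisimType (Q : Type) : ℕ → Type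
  | 0 => Set Q
  | k + 1 => Set Q × Set (BisimType Q k)

instance BisimType.finite (Q : Type) [Finite Q] : ∀ k, Finite (BisimType Q k)
  | 0 => inferInstanceAs (Finite (Set Q))
  | k + 1 =>
    have := BisimType.finite Q k
    inferInstanceAs (Finite (Set Q × Set (BisimType Q k)))

namespace KModel

/-- The `k`-bisimulation type of a point over the letters in `P`. -/
def bisimType (P : Set V) : (k : ℕ) → (M : KModel V) → M.W → BisimType P k
  | 0, M, w => {a : P | M.val w a}
  | k + 1, M, w => ({a : P | M.val w a}, bisimType P k M '' {v | M.R w v})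

theorem bisimType_zero_eq {P : Set V} {M N : KModel V} {w : M.W} {v : N.W} :
    bisimType P 0 M w = bisimType P 0 N v ↔ ∀ a ∈ P, (M.val w a ↔ N.val v a) := by
  refine (Set.ext_iff (α := P)).trans ?_
  exact Subtype.forall

theorem bisimType_succ_eq {P : Set V} {k : ℕ} {M N : KModel V} {w : M.W} {v : N.W} :
    bisimType P (k + 1) M w = bisimType P (k + 1) N v ↔
      (∀ a ∈ P, (M.val w a ↔ N.val v a)) ∧
      (∀ w', M.R w w' → ∃ v', N.R v v' ∧ bisimType P k M w' = bisimType P k N v') ∧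
      (∀ v', N.R v v' → ∃ w', M.R w w' ∧ bisimType P k M w' = bisimType P k N v') := by
  refine (Prod.ext_iff (α := Set P) (β := Set (BisimType P k))).trans (and_congr ?_ ?_)
  · refine (Set.ext_iff (α := P)).trans ?_
    simp [bisimType]
  · exact Set.image_eq_image_iff_exists

theorem val_iff_of_bisimType_eq {P : Set V} {k : ℕ} {M N : KModel V} {w : M.W} {v : N.W}
    (h : bisimType P k M w = bisimType P k N v) : ∀ a ∈ P, (M.val w a ↔ N.val v a) := by
  cases k with
  | zero => exact bisimType_zero_eq.1 h
  | succ k => exact (bisimType_succ_eq.1 h).1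

end KModel

open KModel

theorem IsBisim.bisimType_eq {P : Set V} {M N : KModel V} {B : M.W → N.W → Prop}
    (hB : IsBisim P M N B) (k : ℕ) {w : M.W} {v : N.W} (h : B w v) :
    bisimType P k M w = bisimType P k N v := by
  induction k generalizing w v with
  | zero => exact bisimType_zero_eq.2 (hB.1 w v h)
  | succ k ih =>
    refine bisimType_succ_eq.2 ⟨hB.1 w v h, fun w' hw => ?_, fun v' hv => ?_⟩
    · obtain ⟨v', hv, hb⟩ := hB.2.1 w v h w' hw
      exact ⟨v', hv, ih hb⟩
    · obtain ⟨w', hw, hb⟩ := hB.2.2 w v h v' hv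
      exact ⟨w', hw, ih hb⟩

theorem TeamBisim.image_bisimType_eq {P : Set V} {M N : KModel V} {X : Set M.W} {Y : Set N.W}
    (h : TeamBisim P M X N Y) (k : ℕ) : bisimType P k M '' X = bisimType P k N '' Y := by
  refine Set.image_eq_image_iff_exists.2 ⟨fun x hx => ?_, fun y hy => ?_⟩
  · obtain ⟨y, hy, B, hB, hb⟩ := h.1 x hx
    exact ⟨y, hy, hB.bisimType_eq k hb⟩
  · obtain ⟨x, hx, B, hB, hb⟩ := h.2 y hy
    exact ⟨x, hx, hB.bisimType_eq k hb⟩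

namespace MForm

/-- Modal depth. -/
def depth : MForm V → ℕ
  | .var _ => 0
  | .nvar _ => 0
  | .bot => 0
  | .ne => 0
  | .and φ ψ => max φ.depth ψ.depth
  | .tens φ ψ => max φ.depth ψ.depth
  | .or φ ψ => max φ.depth ψ.depth
  | .dia φ => φ.depth + 1
  | .box φ => φ.depth + 1

end MForm

theorem finite_mletters (φ : MForm V) : (mletters φ).Finite := by
  induction φ with
  | var | nvar => exact Set.finite_singleton _
  | bot | ne => exact Set.finite_empty
  | and _ _ h₁ h₂ | tens _ _ h₁ h₂ | or _ _ h₁ h₂ => exact h₁.union h₂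
  | dia _ h | box _ h => exact h

/-- A formula of depth at most `k` is preserved between teams realizing the same `k`-types. -/
theorem MSat.of_image_bisimType_eq {Q : Set V} {φ : MForm V} (hQ : mletters φ ⊆ Q) {k : ℕ}
    (hk : φ.depth ≤ k) {M N : KModel V} {X : Set M.W} {Y : Set N.W}
    (h : bisimType Q k M '' X = bisimType Q k N '' Y) (hs : MSat M X φ) : MSat N Y φ := by
  induction φ generalizing k X Y with
  | var a =>
    intro y hy
    obtain ⟨x, hx, e⟩ := (Set.image_eq_image_iff_exists.1 h).2 y hy
    exact (val_iff_of_bisimType_eq e a (hQ rfl)).1 (hs x hx)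
  | nvar a =>
    intro y hy
    obtain ⟨x, hx, e⟩ := (Set.image_eq_image_iff_exists.1 h).2 y hy
    exact fun hn => hs x hx ((val_iff_of_bisimType_eq e a (hQ rfl)).2 hn)
  | bot =>
    have hX : X = ∅ := hs
    rw [hX, Set.image_empty] at h
    exact Set.image_eq_empty.1 h.symm
  | ne =>
    rintro rfl
    rw [Set.image_empty] at h
    exact hs (Set.image_eq_empty.1 h)
  | and φ ψ ih₁ ih₂ =>
    exact ⟨ih₁ (Set.subset_union_left.trans hQ) (le_of_max_le_left hk) h hs.1,
      ih₂ (Set.subset_union_right.trans hQ) (le_of_max_le_right hk) h hs.2⟩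
  | or φ ψ ih₁ ih₂ =>
    exact hs.imp (ih₁ (Set.subset_union_left.trans hQ) (le_of_max_le_left hk) h)
      (ih₂ (Set.subset_union_right.trans hQ) (le_of_max_le_right hk) h)
  | tens φ ψ ih₁ ih₂ =>
    obtain ⟨X₁, X₂, rfl, h₁, h₂⟩ := hs
    rw [Set.image_eq_image_iff_exists] at h
    have restrict : ∀ Z : Set M.W, Z ⊆ X₁ ∪ X₂ → bisimType Q k M '' Z =
        bisimType Q k N '' {y ∈ Y | ∃ x ∈ Z, bisimType Q k M x = bisimType Q k N y} := by
      intro Z hZ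
      refine Set.image_eq_image_iff_exists.2 ⟨fun x hx => ?_, fun y hy => hy.2⟩
      obtain ⟨y, hy, e⟩ := h.1 x (hZ hx)
      exact ⟨y, ⟨hy, x, hx, e⟩, e⟩
    refine ⟨_, _, ?_,
      ih₁ (Set.subset_union_left.trans hQ) (le_of_max_le_left hk)
        (restrict X₁ Set.subset_union_left) h₁,
      ih₂ (Set.subset_union_right.trans hQ) (le_of_max_le_right hk)
        (restrict X₂ Set.subset_union_right) h₂⟩
    ext y
    constructor
    · intro hy
      obtain ⟨x, hx | hx, e⟩ := h.2 y hy
      · exact Or.inl ⟨hy, x, hx, e⟩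
      · exact Or.inr ⟨hy, x, hx, e⟩
    · rintro (hy | hy) <;> exact hy.1
  | dia φ ih =>
    obtain ⟨X', ⟨hX₁, hX₂⟩, hs⟩ := hs
    obtain ⟨k, rfl⟩ : ∃ j, k = j + 1 := ⟨k - 1, by simp only [MForm.depth] at hk; omega⟩
    rw [Set.image_eq_image_iff_exists] at h
    refine ⟨{y' | (∃ y ∈ Y, N.R y y') ∧ ∃ x' ∈ X', bisimType Q k M x' = bisimType Q k N y'},
      ⟨fun y hy => ?_, fun y' hy' => hy'.1⟩,
      ih hQ (Nat.le_of_succ_le_succ hk) (Set.image_eq_image_iff_exists.2 ⟨fun x' hx' => ?_,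
        fun y' hy' => hy'.2⟩) hs⟩
    · obtain ⟨x, hx, e⟩ := h.2 y hy
      obtain ⟨x', hx', hR⟩ := hX₁ x hx
      obtain ⟨y', hR', e'⟩ := (bisimType_succ_eq.1 e).2.1 x' hR
      exact ⟨y', ⟨⟨y, hy, hR'⟩, x', hx', e'⟩, hR'⟩
    · obtain ⟨x, hx, hR⟩ := hX₂ x' hx'
      obtain ⟨y, hy, e⟩ := h.1 x hx
      obtain ⟨y', hR', e'⟩ := (bisimType_succ_eq.1 e).2.1 x' hR
      exact ⟨y', ⟨⟨y, hy, hR'⟩, x', hx', e'⟩, e'⟩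
  | box φ ih =>
    obtain ⟨k, rfl⟩ : ∃ j, k = j + 1 := ⟨k - 1, by simp only [MForm.depth] at hk; omega⟩
    rw [Set.image_eq_image_iff_exists] at h
    refine ih (X := M.img X) (Y := N.img Y) hQ (Nat.le_of_succ_le_succ hk)
      (Set.image_eq_image_iff_exists.2 ⟨?_, ?_⟩) hs
    · rintro x' ⟨x, hx, hR⟩
      obtain ⟨y, hy, e⟩ := h.1 x hx
      obtain ⟨y', hR', e'⟩ := (bisimType_succ_eq.1 e).2.1 x' hR
      exact ⟨y', ⟨y, hy, hR'⟩, e'⟩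
    · rintro y' ⟨y, hy, hR⟩
      obtain ⟨x, hx, e⟩ := h.2 y hy
      obtain ⟨x', hR', e'⟩ := (bisimType_succ_eq.1 e).2.2 y' hR
      exact ⟨x', ⟨x, hx, hR'⟩, e'⟩

/-- A team property defined by some formula. -/
def TeamDefinable (D : (M : KModel V) → Set M.W → Prop) : Prop :=
  ∃ θ : MForm V, ∀ M X, MSat M X θ ↔ D M X

/-- A point property whose universal lift to teams is defined by some formula. -/
def FlatDefinable (C : (M : KModel V) → M.W → Prop) : Prop :=
  TeamDefinable fun M X => ∀ w ∈ X, C M w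

theorem TeamDefinable.and {D E : (M : KModel V) → Set M.W → Prop} (hD : TeamDefinable D)
    (hE : TeamDefinable E) : TeamDefinable fun M X => D M X ∧ E M X := by
  obtain ⟨θ, hθ⟩ := hD
  obtain ⟨η, hη⟩ := hE
  exact ⟨.and θ η, fun M X => and_congr (hθ M X) (hη M X)⟩

theorem TeamDefinable.exists_mem {ι : Type*} {s : Set ι} (hs : s.Finite)
    {D : ι → (M : KModel V) → Set M.W → Prop} (hD : ∀ i, TeamDefinable (D i)) :
    TeamDefinable fun M X => ∃ i ∈ s, D i M X := by
  induction s, hs using Set.Finite.induction_on with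
  | empty => exact ⟨.and .bot .ne, fun M X => by simp [MSat]⟩
  | @insert i s _ _ ih =>
    obtain ⟨θ, hθ⟩ := ih
    obtain ⟨η, hη⟩ := hD i
    exact ⟨.or η θ, fun M X => by simp [MSat, hθ, hη]⟩

theorem FlatDefinable.congr {C D : (M : KModel V) → M.W → Prop} (hC : FlatDefinable C)
    (h : ∀ M w, C M w ↔ D M w) : FlatDefinable D := by
  obtain ⟨θ, hθ⟩ := hC
  exact ⟨θ, fun M X => by simp only [hθ, h]⟩

theorem FlatDefinable.and {C D : (M : KModel V) → M.W → Prop} (hC : FlatDefinable C)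
    (hD : FlatDefinable D) : FlatDefinable fun M w => C M w ∧ D M w := by
  obtain ⟨θ, hθ⟩ := TeamDefinable.and hC hD
  exact ⟨θ, fun M X => by rw [hθ]; simp only [imp_and, forall_and]⟩

theorem FlatDefinable.forall_mem {ι : Type*} {s : Set ι} (hs : s.Finite)
    {C : ι → (M : KModel V) → M.W → Prop} (hC : ∀ i, FlatDefinable (C i)) :
    FlatDefinable fun M w => ∀ i ∈ s, C i M w := by
  induction s, hs using Set.Finite.induction_on with
  | empty => exact ⟨.or .bot .ne, fun M X => by simp [MSat, em]⟩
  | @insert i s _ _ ih => exact ((hC i).and ih).congr fun M w => by simp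

theorem FlatDefinable.exists_mem {ι : Type*} {s : Set ι} (hs : s.Finite)
    {C : ι → (M : KModel V) → M.W → Prop} (hC : ∀ i, FlatDefinable (C i)) :
    FlatDefinable fun M w => ∃ i ∈ s, C i M w := by
  induction s, hs using Set.Finite.induction_on with
  | empty => exact ⟨.bot, fun M X => by simp [MSat, Set.eq_empty_iff_forall_notMem]⟩
  | @insert i s _ _ ih =>
    obtain ⟨θ, hθ⟩ := ih
    obtain ⟨η, hη⟩ := hC i
    refine ⟨.tens η θ, fun M X => ?_⟩
    simp only [MSat, hθ, hη, Set.exists_mem_insert]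
    constructor
    · rintro ⟨X₁, X₂, rfl, h₁, h₂⟩ w (hw | hw)
      · exact Or.inl (h₁ w hw)
      · exact Or.inr (h₂ w hw)
    · intro h
      refine ⟨{w ∈ X | C i M w}, {w ∈ X | ∃ j ∈ s, C j M w}, ?_, fun w hw => hw.2,
        fun w hw => hw.2⟩
      ext w
      exact ⟨fun hw => (h w hw).imp (⟨hw, ·⟩) (⟨hw, ·⟩), by rintro (hw | hw) <;> exact hw.1⟩

theorem FlatDefinable.dia {C : (M : KModel V) → M.W → Prop} (hC : FlatDefinable C) :
    FlatDefinable fun M w => ∃ v, M.R w v ∧ C M v := by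
  obtain ⟨θ, hθ⟩ := hC
  refine ⟨.dia θ, fun M X => ?_⟩
  simp only [MSat, hθ]
  constructor
  · rintro ⟨Y, hR, hY⟩ w hw
    obtain ⟨v, hv, h⟩ := hR.1 w hw
    exact ⟨v, h, hY v hv⟩
  · intro h
    refine ⟨{v | (∃ w ∈ X, M.R w v) ∧ C M v}, ⟨fun w hw => ?_, fun v hv => hv.1⟩,
      fun v hv => hv.2⟩
    obtain ⟨v, hR, hv⟩ := h w hw
    exact ⟨v, ⟨⟨w, hw, hR⟩, hv⟩, hR⟩

theorem FlatDefinable.box {C : (M : KModel V) → M.W → Prop} (hC : FlatDefinable C) :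
    FlatDefinable fun M w => ∀ v, M.R w v → C M v := by
  obtain ⟨θ, hθ⟩ := hC
  refine ⟨.box θ, fun M X => ?_⟩
  simp only [MSat, hθ, KModel.img]
  exact ⟨fun h w hw v hv => h v ⟨w, hw, hv⟩, fun h v ⟨w, hw, hv⟩ => h w hw v hv⟩

theorem flatDefinable_val_iff (a : V) (b : Prop) : FlatDefinable fun M w => (M.val w a ↔ b) := by
  by_cases hb : b
  · exact ⟨.var a, fun M X => by simp [MSat, hb]⟩
  · exact ⟨.nvar a, fun M X => by simp [MSat, hb]⟩

theorem flatDefinable_val_eq {P : Set V} [Finite P] (A : Set P) :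
    FlatDefinable fun (M : KModel V) w => {a : P | M.val w a} = A := by
  refine (FlatDefinable.forall_mem (Set.finite_univ (α := P))
    fun a => flatDefinable_val_iff (a : V) (a ∈ A)).congr fun M w => ?_
  simp [Set.ext_iff]

/-- Characteristic formulas of pointed models. -/
theorem flatDefinable_bisimType_eq {P : Set V} [Finite P] (k : ℕ) (t : BisimType P k) :
    FlatDefinable fun M w => bisimType P k M w = t := by
  induction k with
  | zero => exact flatDefinable_val_eq t
  | succ k ih =>
    obtain ⟨A, S⟩ := t
    refine ((flatDefinable_val_eq A).and
      ((FlatDefinable.exists_mem (Set.toFinite S) ih).box.and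
        (FlatDefinable.forall_mem (Set.toFinite S) fun s => (ih s).dia))).congr fun M w => ?_
    refine Iff.trans ?_ (Prod.ext_iff (α := Set P) (β := Set (BisimType P k))).symm
    refine and_congr Iff.rfl ?_
    refine Iff.trans ?_ (Set.Subset.antisymm_iff
      (a := bisimType P k M '' {v | M.R w v}) (b := S)).symm
    simp [Set.subset_def]

/-- Characteristic formulas of team models. -/
theorem teamDefinable_image_bisimType_eq {P : Set V} [Finite P] (k : ℕ)
    (S : Set (BisimType P k)) : TeamDefinable fun M X => bisimType P k M '' X = S := by
  induction S, Set.toFinite S using Set.Finite.induction_on with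
  | empty => exact ⟨.bot, fun M X => by simp [MSat]⟩
  | @insert t S _ _ ih =>
    obtain ⟨θ, hθ⟩ := ih
    obtain ⟨η, hη⟩ := flatDefinable_bisimType_eq k t
    refine ⟨.tens (.and η .ne) θ, fun M X => ?_⟩
    simp only [MSat, hθ, hη]
    constructor
    · rintro ⟨X₁, X₂, rfl, ⟨h₁, hne⟩, rfl⟩
      rw [Set.image_union, Set.insert_eq]
      congr 1
      obtain ⟨x, hx⟩ := Set.nonempty_iff_ne_empty.2 hne
      exact Set.eq_singleton_iff_unique_mem.2
        ⟨⟨x, hx, h₁ x hx⟩, by rintro _ ⟨y, hy, rfl⟩; exact h₁ y hy⟩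
    · intro h
      refine ⟨{w ∈ X | bisimType P k M w = t}, {w ∈ X | bisimType P k M w ∈ S}, ?_,
        ⟨fun w hw => hw.2, ?_⟩, ?_⟩
      · ext w
        refine ⟨fun hw => ?_, by rintro (hw | hw) <;> exact hw.1⟩
        have : bisimType P k M w ∈ insert t S := h.subset (Set.mem_image_of_mem _ hw)
        exact this.imp (⟨hw, ·⟩) (⟨hw, ·⟩)
      · obtain ⟨w, hw, e⟩ := h.superset (Set.mem_insert t S)
        exact Set.nonempty_iff_ne_empty.1 ⟨w, hw, e⟩
      · ext s
        constructor
        · rintro ⟨w, hw, rfl⟩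
          exact hw.2
        · intro hs
          obtain ⟨w, hw, rfl⟩ := h.superset (Set.mem_insert_of_mem t hs)
          exact ⟨w, ⟨hw, hs⟩, rfl⟩

/-- A team property that depends only on the `k`-types realized in the team is definable. -/
theorem teamDefinable_of_image_bisimType {P : Set V} (hP : P.Finite) (k : ℕ)
    {D : (M : KModel V) → Set M.W → Prop}
    (hD : ∀ M X N Y, bisimType P k M '' X = bisimType P k N '' Y → D M X → D N Y) :
    TeamDefinable D := by
  have := hP.to_subtype
  obtain ⟨θ, hθ⟩ := TeamDefinable.exists_mem
    (Set.toFinite {S : Set (BisimType P k) | ∃ M X, bisimType P k M '' X = S ∧ D M X})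
    fun S => teamDefinable_image_bisimType_eq k S
  refine ⟨θ, fun N Y => (hθ N Y).trans ⟨?_, fun h => ⟨_, ⟨N, Y, rfl, h⟩, rfl⟩⟩⟩
  rintro ⟨_, ⟨M, X, rfl, h⟩, e⟩
  exact hD M X N Y e.symm h

/-- Amalgamation of `N` and `M`: stage `j` consists of pairs of points with the same
`j`-type over `P`, and below stage `0` the model continues as `M`. -/
def amalgam (P : Set V) (N M : KModel V) : KModel V where
  W := {q : ℕ × N.W × M.W // bisimType P q.1 N q.2.1 = bisimType P q.1 M q.2.2} ⊕ M.W
  R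
    | .inl a, .inl b => a.1.1 = b.1.1 + 1 ∧ N.R a.1.2.1 b.1.2.1 ∧ M.R a.1.2.2 b.1.2.2
    | .inl a, .inr m => a.1.1 = 0 ∧ M.R a.1.2.2 m
    | .inr _, .inl _ => False
    | .inr m, .inr m' => M.R m m'
  val
    | .inl a, q => N.val a.1.2.1 q
    | .inr m, q => M.val m q

/-- The projection of the amalgam to `M`. -/
def amalgamProj (P : Set V) (N M : KModel V) : (amalgam P N M).W → M.W :=
  Sum.elim (fun a => a.1.2.2) id

theorem isBisim_amalgamProj (P : Set V) (N M : KModel V) :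
    IsBisim P (amalgam P N M) M fun a m => amalgamProj P N M a = m := by
  refine ⟨?_, ?_, ?_⟩
  · rintro (a | m) _ rfl q hq
    · exact val_iff_of_bisimType_eq a.2 q hq
    · exact Iff.rfl
  · rintro (a | m) _ rfl (b | m') h
    · exact ⟨_, h.2.2, rfl⟩
    · exact ⟨_, h.2, rfl⟩
    · exact h.elim
    · exact ⟨_, h, rfl⟩
  · rintro (⟨⟨j, n, m⟩, e⟩ | m) _ rfl m' h
    · cases j with
      | zero => exact ⟨.inr m', ⟨rfl, h⟩, rfl⟩
      | succ j =>
        obtain ⟨n', hn, e'⟩ := (bisimType_succ_eq.1 e).2.2 m' h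
        exact ⟨.inl ⟨(j, n', m'), e'⟩, ⟨rfl, hn, h⟩, rfl⟩
    · exact ⟨.inr m', h, rfl⟩

theorem bisimType_amalgam (P Q : Set V) (N M : KModel V) (j : ℕ) (n : N.W) (m : M.W)
    (e : bisimType P j N n = bisimType P j M m) :
    bisimType Q j (amalgam P N M) (.inl ⟨(j, n, m), e⟩) = bisimType Q j N n := by
  induction j generalizing n m with
  | zero => exact bisimType_zero_eq.2 fun _ _ => Iff.rfl
  | succ j ih =>
    refine bisimType_succ_eq.2 ⟨fun _ _ => Iff.rfl, ?_, fun n' hn => ?_⟩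
    · rintro (⟨⟨i, n', m'⟩, e'⟩ | m') h
      · obtain rfl : j = i := Nat.succ.inj h.1
        exact ⟨n', h.2.1, ih n' m' e'⟩
      · exact absurd h.1 (Nat.succ_ne_zero j)
    · obtain ⟨m', hm, e'⟩ := (bisimType_succ_eq.1 e).2.1 n' hn
      exact ⟨.inl ⟨(j, n', m'), e'⟩, ⟨rfl, hn, hm⟩, ih n' m' e'⟩

/-- If two teams realize the same `k`-types over `P`, then some team is `P`-bisimilar to the
second one and realizes the same `k`-types as the first one over any other set of letters. -/
theorem exists_teamBisim_of_image_bisimType_eq {P : Set V} (Q : Set V) {k : ℕ} {N M : KModel V}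
    {Y : Set N.W} {X : Set M.W} (h : bisimType P k N '' Y = bisimType P k M '' X) :
    ∃ (N' : KModel V) (Y' : Set N'.W), TeamBisim P N' Y' M X ∧
      bisimType Q k N '' Y = bisimType Q k N' '' Y' := by
  rw [Set.image_eq_image_iff_exists] at h
  refine ⟨amalgam P N M,
    {a | ∃ n ∈ Y, ∃ m ∈ X, ∃ e, a = .inl ⟨(k, n, m), e⟩}, ⟨?_, fun m hm => ?_⟩,
    Set.image_eq_image_iff_exists.2 ⟨fun n hn => ?_, ?_⟩⟩
  · rintro _ ⟨n, hn, m, hm, e, rfl⟩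
    exact ⟨m, hm, _, isBisim_amalgamProj P N M, rfl⟩
  · obtain ⟨n, hn, e⟩ := h.2 m hm
    exact ⟨.inl ⟨(k, n, m), e⟩, ⟨n, hn, m, hm, e, rfl⟩, _, isBisim_amalgamProj P N M, rfl⟩
  · obtain ⟨m, hm, e⟩ := h.1 n hn
    exact ⟨_, ⟨n, hn, m, hm, e, rfl⟩, (bisimType_amalgam P Q N M k n m e).symm⟩
  · rintro _ ⟨n, hn, m, hm, e, rfl⟩
    exact ⟨n, hn, (bisimType_amalgam P Q N M k n m e).symm⟩

/-- elimination of bisimulation quantifiers in `FMTL`: for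
every `FMTL` formula `φ` and letter `p` there is an `FMTL` formula `θ`
equivalent to `∃̃p φ`. -/
theorem fmtl_exq_elimination {V : Type} (φ : MForm V) (p : V) :
    ∃ θ : MForm V, ∀ (M : KModel V) (X : Set M.W),
      MSat M X θ ↔ ∃ (N : KModel V) (Y : Set N.W),
        TeamBisim (mletters φ \ {p}) N Y M X ∧ MSat N Y φ := by
  refine teamDefinable_of_image_bisimType ((finite_mletters φ).subset (Set.sdiff_subset (t := {p}))) φ.depth
    (D := fun M X => ∃ (N : KModel V) (Y : Set N.W),
      TeamBisim (mletters φ \ {p}) N Y M X ∧ MSat N Y φ) ?_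
  rintro M X M' X' h ⟨N, Y, hb, hs⟩
  obtain ⟨N', Y', hb', hQ⟩ := exists_teamBisim_of_image_bisimType_eq (mletters φ)
    ((hb.image_bisimType_eq φ.depth).trans h)
  exact ⟨N', Y', hb', hs.of_image_bisimType_eq subset_rfl le_rfl hQ⟩
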